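/- Let B≥1 and d,T,p,β∈ℕ+ with d ≥ p+1. Let Θ be any transformer parameters with the emulation property. There exists a constant C''>0 depending only on β, p and d such that for every ε∈(0,1) one can choose a threshold S* = S*(d,B,p,β,ε,T) > 0 with the following property: if L∈ℕ+ satisfies L ≤ C''·ε^{−p/(2β)}, then sup_{f∈C_u^β([0,1]^p)} inf over S ≥ S* and H^P∈Q_{B_d(B)}(T,L,S) of ‖f̂_{Θ,H^P,L,p} − f‖_{L^∞([0,1]^p)} ≥ ε. -/

import Mathlib

open scoped BigOperators
open Matrix

noncomputable section

namespace PromptTF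

/-- The ReLU activation function. -/
def relu (x : ℝ) : ℝ := max x 0

/-- The elementary universal activation function (EUAF). -/
def euaf (x : ℝ) : ℝ :=
  if 0 ≤ x then |x - 2 * (⌊(x + 1) / 2⌋ : ℝ)| else x / (1 + |x|)

/-- Parameters of one transformer layer (attention heads and a feed-forward net). -/
structure TFLayer (D : ℕ) where
  M : ℕ
  Q : Fin M → Matrix (Fin D) (Fin D) ℝ
  K : Fin M → Matrix (Fin D) (Fin D) ℝ
  V : Fin M → Matrix (Fin D) (Fin D) ℝ
  width : ℕ
  W1 : Matrix (Fin width) (Fin D) ℝ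
  W2 : Matrix (Fin D) (Fin width) ℝ

/-- Self-attention layer applied to a list of tokens. -/
def attnOut {D : ℕ} (θ : TFLayer D) (H : List (Fin D → ℝ)) : List (Fin D → ℝ) :=
  H.map fun h => fun i =>
    h i + ∑ m : Fin θ.M,
      (H.map fun h' =>
        relu (dotProduct ((θ.Q m).mulVec h) ((θ.K m).mulVec h')) * ((θ.V m).mulVec h') i).sum

/-- One transformer layer `FFN ∘ Attn`, with feed-forward activation `act`. -/
def layerMap {D : ℕ} (act : ℝ → ℝ) (θ : TFLayer D) (H : List (Fin D → ℝ)) :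
    List (Fin D → ℝ) :=
  (attnOut θ H).map fun h => fun i =>
    h i + (θ.W2.mulVec fun k => act ((θ.W1.mulVec h) k)) i

/-- Multi-layer transformer, all activations ReLU. -/
def tfForward {D : ℕ} (Θ : List (TFLayer D)) (H : List (Fin D → ℝ)) : List (Fin D → ℝ) :=
  Θ.foldl (fun H' θ => layerMap relu θ H') H

/-- Multi-layer transformer whose first feed-forward layer uses the EUAF activation. -/
def tfForwardEUAF {D : ℕ} (Θ : List (TFLayer D)) (H : List (Fin D → ℝ)) :
    List (Fin D → ℝ) :=
  match Θ with
  | [] => H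
  | θ :: rest => rest.foldl (fun H' θ' => layerMap relu θ' H') (layerMap euaf θ H)

/-- Sequential (autoregressive) generation: append the last output column repeatedly. -/
def genTokens {D : ℕ} (forward : List (Fin D → ℝ) → List (Fin D → ℝ))
    (H : List (Fin D → ℝ)) : ℕ → List (Fin D → ℝ)
  | 0 => H
  | v + 1 =>
      genTokens forward H v ++ [(forward (genTokens forward H v)).getLastD (fun _ => 0)]

/-- The token at one-based position `m` in the generated sequence. -/
def tokenAt {D : ℕ} (forward : List (Fin D → ℝ) → List (Fin D → ℝ))
    (H : List (Fin D → ℝ)) (m : ℕ) : Fin D → ℝ :=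
  (genTokens forward H (m - H.length)).getD (m - 1) (fun _ => 0)

/-- A token with word embedding `u`, layer index `w`, position `j` and scale `S`:
`(uᵀ, 0_{3d+4}ᵀ, 1, S, S·w, S·j)ᵀ ∈ ℝ^{4d+8}`. -/
def promptToken (d : ℕ) (u : Fin d → ℝ) (w : ℤ) (j : ℕ) (S : ℝ) : Fin (4 * d + 8) → ℝ :=
  fun i =>
    if h : (i : ℕ) < d then u ⟨i, h⟩
    else if (i : ℕ) = 4 * d + 4 then 1
    else if (i : ℕ) = 4 * d + 5 then S
    else if (i : ℕ) = 4 * d + 6 then S * w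
    else if (i : ℕ) = 4 * d + 7 then S * j
    else 0

/-- First `d` coordinates of a token. -/
def firstd (d : ℕ) (h : Fin (4 * d + 8) → ℝ) : Fin d → ℝ :=
  fun k => h (Fin.castLE (by omega) k)

/-- Initial input: `T` prompt tokens followed by `N` data tokens. -/
def initialInput (d T N : ℕ) (u : Fin T → Fin d → ℝ) (w : Fin T → ℕ) (S : ℝ)
    (z : Fin N → Fin d → ℝ) : List (Fin (4 * d + 8) → ℝ) :=
  ((List.finRange T).map fun j => promptToken d (u j) (w j) ((j : ℕ) + 1) S)
    ++ ((List.finRange N).map fun i => promptToken d (z i) 0 (T + (i : ℕ) + 1) S)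

/-- The closed Euclidean ball of radius `B` in `ℝ^d`. -/
def eball (d : ℕ) (B : ℝ) : Set (Fin d → ℝ) :=
  {v | Real.sqrt (∑ k, v k ^ 2) ≤ B}

/-- Data of a valid prompt in `P_U(T, L, S)`: word embeddings in `U`,
layer indices in `{1, …, 2L}`. -/
def ValidPrompt {d : ℕ} (U : Set (Fin d → ℝ)) (T L : ℕ)
    (u : Fin T → Fin d → ℝ) (w : Fin T → ℕ) : Prop :=
  (∀ j, u j ∈ U) ∧ ∀ j, 1 ≤ w j ∧ w j ≤ 2 * L

/-- The virtual weight matrix `W^P_ℓ` (without the first-layer correction term). -/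
def WPmat {d T : ℕ} (u : Fin T → Fin d → ℝ) (w : Fin T → ℕ) (ℓ : ℕ) :
    Matrix (Fin d) (Fin d) ℝ :=
  ∑ j : Fin T,
    if h : (j : ℕ) + 1 < T then
      (if w j = 2 * ℓ - 1 ∧ w ⟨(j : ℕ) + 1, h⟩ = 2 * ℓ then
        vecMulVec (u j) (u ⟨(j : ℕ) + 1, h⟩) else 0)
    else 0

/-- The first-layer correction term `(h_T)_{1:d} 1{w_T=1} Σ_{j'} (h_{j'})_{1:d}ᵀ 1{w_{j'}=1}`. -/
def WPcorr {d T : ℕ} (u : Fin T → Fin d → ℝ) (w : Fin T → ℕ) :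
    Matrix (Fin d) (Fin d) ℝ :=
  if hT : 0 < T then
    (if w ⟨T - 1, by omega⟩ = 1 then
      vecMulVec (u ⟨T - 1, by omega⟩) (∑ j : Fin T, if w j = 1 then u j else 0)
    else 0)
  else 0

/-- The virtual first-layer weight matrix `W^P_{1,i}`; `first` indicates `i = 1`. -/
def WPone {d T : ℕ} (u : Fin T → Fin d → ℝ) (w : Fin T → ℕ) (first : Bool) :
    Matrix (Fin d) (Fin d) ℝ :=
  WPmat u w 1 + if first then WPcorr u w else 0

/-- The family of virtual weight matrices of a prompt, for the data token with
zero-based index `i`. -/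
def WPfam {d T : ℕ} (u : Fin T → Fin d → ℝ) (w : Fin T → ℕ) (i : ℕ) :
    ℕ → Matrix (Fin d) (Fin d) ℝ :=
  fun ℓ => if ℓ = 1 then WPone u w (i == 0) else WPmat u w ℓ

/-- Output of the virtual network after `ℓ` layers:
`vnetOut … ℓ = W_ℓ act(W_{ℓ-1} act( ⋯ act(W_1 z) ⋯ ))`. -/
def vnetOut (d : ℕ) (act : ℝ → ℝ) (Ws : ℕ → Matrix (Fin d) (Fin d) ℝ)
    (z : Fin d → ℝ) : ℕ → Fin d → ℝ
  | 0 => z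
  | ℓ + 1 =>
      (Ws (ℓ + 1)).mulVec fun k =>
        if ℓ = 0 then vnetOut d act Ws z ℓ k else act (vnetOut d act Ws z ℓ k)

/-- The emulation property: for every admissible prompt and data tokens, the sequentially
generated tokens realize the virtual neural network encoded by the prompt
(with activation `act`). -/
def EmulatesWith (d : ℕ)
    (forward : List (Fin (4 * d + 8) → ℝ) → List (Fin (4 * d + 8) → ℝ))
    (act : ℝ → ℝ) : Prop :=
  ∀ B : ℝ, 1 ≤ B → ∀ T L : ℕ, 0 < T → 0 < L →
  ∀ U : Set (Fin d → ℝ), U ⊆ eball d B →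
  ∀ S : ℝ, max ((d : ℝ) * B ^ (4 * L) * (T : ℝ) ^ (2 * L)) (2 * (L : ℝ)) ≤ S →
  ∀ (u : Fin T → Fin d → ℝ) (w : Fin T → ℕ), ValidPrompt U T L u w →
  ∀ N : ℕ, 0 < N → ∀ z : Fin N → Fin d → ℝ, (∀ i k, z i k ∈ Set.Icc (0 : ℝ) 1) →
  ∀ (i : Fin N) (ℓ : ℕ), 1 ≤ ℓ → ℓ ≤ L →
    tokenAt forward (initialInput d T N u w S z) (T + N * ℓ + (i : ℕ) + 1)
      = promptToken d (vnetOut d act (WPfam u w (i : ℕ)) (z i) ℓ) (-(ℓ : ℤ))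
          (T + N * ℓ + (i : ℕ) + 1) S

/-- The embedding `x ↦ (xᵀ, 1, 0_{d-p-1}ᵀ)ᵀ ∈ ℝ^d` of an input `x ∈ ℝ^p`. -/
def embed (d p : ℕ) (x : Fin p → ℝ) : Fin d → ℝ :=
  fun k => if h : (k : ℕ) < p then x ⟨k, h⟩ else if (k : ℕ) = p then 1 else 0

/-- The function approximator `f̂_{Θ,H^P,L,p}`: first coordinate of the token at
position `T+1+L` generated from the prompt followed by the single data token. -/
def fhat {d : ℕ} (forward : List (Fin (4 * d + 8) → ℝ) → List (Fin (4 * d + 8) → ℝ))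
    {T : ℕ} (u : Fin T → Fin d → ℝ) (w : Fin T → ℕ) (S : ℝ) (L p : ℕ)
    (x : Fin p → ℝ) : ℝ :=
  tokenAt forward (initialInput d T 1 u w S fun _ => embed d p x) (T + 1 + L)
    ⟨0, by omega⟩

/-- The unit cube `[0,1]^p`. -/
def unitCube (p : ℕ) : Set (Fin p → ℝ) := Set.Icc 0 1

/-- The sup-distance `‖f - g‖_{L^∞([0,1]^p)}`. -/
def supDist (p : ℕ) (f g : (Fin p → ℝ) → ℝ) : ℝ :=
  ⨆ x : unitCube p, |f x.1 - g x.1|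

/-- Partial derivative (within the unit cube) in coordinate direction `i`. -/
def pderivW (p : ℕ) (i : Fin p) (f : (Fin p → ℝ) → ℝ) : (Fin p → ℝ) → ℝ :=
  fun x => fderivWithin ℝ f (unitCube p) x (Pi.single i 1)

/-- Iterated partial derivative along a list of coordinate directions. -/
def pderivList (p : ℕ) : List (Fin p) → ((Fin p → ℝ) → ℝ) → (Fin p → ℝ) → ℝ
  | [], f => f
  | i :: is, f => pderivList p is (pderivW p i f)

/-- The unit ball `C_u^β([0,1]^p)` of `β`-times continuously differentiable functions with
all partial derivatives of order `≤ β` bounded by `1` on the cube. -/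
def Hclass (p β : ℕ) : Set ((Fin p → ℝ) → ℝ) :=
  {f | ContDiffOn ℝ β f (unitCube p) ∧
    ∀ ls : List (Fin p), ls.length ≤ β →
      ∀ x ∈ unitCube p, |pderivList p ls f x| ≤ 1}

/-- `U_{d,r}` : the span of the first `r` standard basis vectors of `ℝ^d`. -/
def spanFirst (d r : ℕ) : Set (Fin d → ℝ) :=
  {v | ∀ k : Fin d, r ≤ (k : ℕ) → v k = 0}

/-- Hidden layers of a standard ReLU network of width `r` (with biases). -/
def nnHidden {p r : ℕ} (W0 : Matrix (Fin r) (Fin p) ℝ) (b0 : Fin r → ℝ)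
    (Wm : ℕ → Matrix (Fin r) (Fin r) ℝ) (bm : ℕ → Fin r → ℝ) (x : Fin p → ℝ) :
    ℕ → Fin r → ℝ
  | 0 => fun i => W0.mulVec x i + b0 i
  | k + 1 => fun i =>
      (Wm k).mulVec (fun j => relu (nnHidden W0 b0 Wm bm x k j)) i + bm k i

/-- The class `N(r,p,L)` of ReLU networks `ℝ^p → ℝ` of width `r` and depth `L`
(`L` affine maps with ReLU in between). -/
def NNclass (r p L : ℕ) : Set ((Fin p → ℝ) → ℝ) :=
  {f | if L = 1 then ∃ (a : Fin p → ℝ) (b : ℝ), f = fun x => (∑ i, a i * x i) + b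
    else ∃ (W0 : Matrix (Fin r) (Fin p) ℝ) (b0 : Fin r → ℝ)
      (Wm : ℕ → Matrix (Fin r) (Fin r) ℝ) (bm : ℕ → Fin r → ℝ)
      (wL : Fin r → ℝ) (bL : ℝ),
      f = fun x => (∑ j, wL j * relu (nnHidden W0 b0 Wm bm x (L - 2) j)) + bL}

/-- Operator norm (w.r.t. the Euclidean norm) of a `d × d` matrix. -/
def opNorm {d : ℕ} (W : Matrix (Fin d) (Fin d) ℝ) : ℝ :=
  ‖LinearMap.toContinuousLinearMap (Matrix.toEuclideanLin W)‖

/-- The class `W(r,d,U,B)` of coarse weight matrices. -/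
def coarseW (d r : ℕ) (U : Set (Fin d → ℝ)) (B : ℝ) :
    Set (Matrix (Fin d) (Fin d) ℝ) :=
  {W | (∃ ut uu : Fin r → Fin d → ℝ,
        (∀ k, ut k ∈ U) ∧ (∀ k, uu k ∈ U) ∧ W = ∑ k, vecMulVec (ut k) (uu k)) ∧
    opNorm W ≤ B ^ 2}

open Classical in
/-- Number of nonzero parameter entries of one transformer layer. -/
def layerNonzero {D : ℕ} (θ : TFLayer D) : ℕ :=
  (Finset.univ.filter fun p : Fin θ.M × Fin D × Fin D => θ.Q p.1 p.2.1 p.2.2 ≠ 0).card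
  + (Finset.univ.filter fun p : Fin θ.M × Fin D × Fin D => θ.K p.1 p.2.1 p.2.2 ≠ 0).card
  + (Finset.univ.filter fun p : Fin θ.M × Fin D × Fin D => θ.V p.1 p.2.1 p.2.2 ≠ 0).card
  + (Finset.univ.filter fun p : Fin θ.width × Fin D => θ.W1 p.1 p.2 ≠ 0).card
  + (Finset.univ.filter fun p : Fin D × Fin θ.width => θ.W2 p.1 p.2 ≠ 0).card

/-- Total number of nonzero parameter entries of a transformer. -/
def tfNonzero {D : ℕ} (Θ : List (TFLayer D)) : ℕ := (Θ.map layerNonzero).sum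

/-- All parameter entries of one layer bounded in absolute value by `c`. -/
def layerEntriesBounded {D : ℕ} (θ : TFLayer D) (c : ℝ) : Prop :=
  (∀ m i j, |θ.Q m i j| ≤ c) ∧ (∀ m i j, |θ.K m i j| ≤ c) ∧ (∀ m i j, |θ.V m i j| ≤ c)
  ∧ (∀ i j, |θ.W1 i j| ≤ c) ∧ ∀ i j, |θ.W2 i j| ≤ c

end PromptTF
end

open PromptTF Matrix

open MvPolynomial in
theorem MvPolynomial.exists_eval_ne_zero_of_isOpen {ι : Type*} [Finite ι] {F : MvPolynomial ι ℝ}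
    (hF : F ≠ 0) {U : Set (ι → ℝ)} (hU : IsOpen U) (hne : U.Nonempty) :
    ∃ x ∈ U, eval x F ≠ 0 := by
  classical
  have := Fintype.ofFinite ι
  obtain ⟨x, hx⟩ := hne
  obtain ⟨ε, hε, hball⟩ := Metric.isOpen_iff.1 hU x hx
  by_contra! hcon
  refine hF (funext_set (fun i => Metric.ball (x i) ε) (fun i => ?_) fun y hy => ?_)
  · rw [Real.ball_eq_Ioo]
    exact Set.Ioo_infinite (by linarith)
  · rw [hcon y (hball ?_), map_zero]
    rw [ball_pi _ hε]
    exact hy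

open MvPolynomial in
theorem MvPolynomial.totalDegree_pderiv_le {ι R : Type*} [CommSemiring R] (i : ι)
    (F : MvPolynomial ι R) : (pderiv i F).totalDegree ≤ F.totalDegree := by
  classical
  conv_lhs => rw [F.as_sum, map_sum]
  refine totalDegree_finsetSum_le fun s hs => ?_
  rw [pderiv_monomial]
  refine (totalDegree_monomial_le _ _).trans (le_trans ?_ (le_totalDegree hs))
  exact Finsupp.sum_le_sum_index (h := fun _ e => e) (tsub_le_self (α := ι →₀ ℕ))
    (fun _ _ => monotone_id) (by simp)

open MvPolynomial in
theorem MvPolynomial.hasDerivAt_eval_update {ι : Type*} [DecidableEq ι] (F : MvPolynomial ι ℝ)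
    (x : ι → ℝ) (i : ι) (t : ℝ) :
    HasDerivAt (fun t => eval (Function.update x i t) F)
      (eval (Function.update x i t) (pderiv i F)) t := by
  induction F using MvPolynomial.induction_on with
  | C a => simpa using hasDerivAt_const t a
  | add p q hp hq => simpa [Pi.add_def] using! hp.add hq
  | mul_X p j hp =>
    have hj : HasDerivAt (fun t => eval (Function.update x i t) (X j : MvPolynomial ι ℝ))
        (eval (Function.update x i t) (pderiv i (X j))) t := by
      by_cases h : j = i
      · subst h
        simpa using hasDerivAt_id' t
      · simpa [h, pderiv_X_of_ne h] using hasDerivAt_const t (x j)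
    have := hp.mul hj
    simp only [Derivation.leibniz, map_add, smul_eq_mul, map_mul]
    convert! this using 1
    ring

open MvPolynomial in
/-- A linear form and polynomials in as many variables satisfy a polynomial relation whose degree
in the linear form is controlled by the degrees of the polynomials. -/
theorem MvPolynomial.exists_relation {ι : Type*} [Fintype ι] (l : MvPolynomial ι ℝ)
    (hl : l.totalDegree ≤ 1) (G : ι → MvPolynomial ι ℝ) (E : ℕ)
    (hG : ∀ i, (G i).totalDegree ≤ E) (A : ℕ)
    (hA : (Fintype.card ι * E + 1) ^ Fintype.card ι ≤ A) :
    ∃ q : Fin (A + 1) → MvPolynomial ι ℝ, q ≠ 0 ∧ ∑ a : Fin (A + 1), l ^ (a : ℕ) * aeval G (q a) = 0 := by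
  classical
  set W := Fintype.card ι with hW
  set M := A + W * (A * E) with hM
  let term : Fin (A + 1) × (ι → Fin (A + 1)) → MvPolynomial ι ℝ :=
    fun ab => l ^ (ab.1 : ℕ) * ∏ i, G i ^ (ab.2 i : ℕ)
  have hdeg : ∀ ab, (term ab).totalDegree ≤ M := by
    intro ab
    refine (totalDegree_mul _ _).trans (add_le_add ?_ ?_)
    · refine (totalDegree_pow _ _).trans ?_
      calc (ab.1 : ℕ) * l.totalDegree ≤ A * 1 :=
            Nat.mul_le_mul (Nat.lt_succ_iff.1 ab.1.2) hl
        _ = A := mul_one A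
    · refine (totalDegree_finsetProd _ _).trans ?_
      refine (Finset.sum_le_card_nsmul _ _ (A * E) fun i _ => ?_).trans (by simp [hW])
      exact (totalDegree_pow _ _).trans
        (Nat.mul_le_mul (Nat.lt_succ_iff.1 (ab.2 i).2) (hG i))
  let toF : (ι → Fin (M + 1)) → ι →₀ ℕ := fun b => Finsupp.equivFunOnFinite.symm fun i => (b i : ℕ)
  let Φ : (Fin (A + 1) × (ι → Fin (A + 1)) → ℝ) →ₗ[ℝ] ((ι → Fin (M + 1)) → ℝ) :=
    { toFun := fun lam b => coeff (toF b) (∑ ab, lam ab • term ab)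
      map_add' := by
        intro x y
        ext b
        simp [add_smul, Finset.sum_add_distrib]
      map_smul' := by
        intro c x
        ext b
        simp [Finset.mul_sum, mul_assoc, coeff_sum] }
  have hker : LinearMap.ker Φ ≠ ⊥ := by
    apply LinearMap.ker_ne_bot_of_finrank_lt
    simp only [Module.finrank_fintype_fun_eq_card, Fintype.card_prod, Fintype.card_fun,
      Fintype.card_fin]
    have h1 : M + 1 ≤ (A + 1) * (W * E + 1) := by rw [hM]; ring_nf; nlinarith [Nat.zero_le (W * E)]
    calc (M + 1) ^ W ≤ ((A + 1) * (W * E + 1)) ^ W := Nat.pow_le_pow_left h1 _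
      _ = (W * E + 1) ^ W * (A + 1) ^ W := by rw [mul_pow, mul_comm]
      _ ≤ A * (A + 1) ^ W := Nat.mul_le_mul_right _ hA
      _ < (A + 1) * (A + 1) ^ W := Nat.mul_lt_mul_of_pos_right (Nat.lt_succ_self A) (by positivity)
  obtain ⟨lam, hlam, hne⟩ := Submodule.exists_mem_ne_zero_of_ne_bot hker
  have hzero : ∑ ab, lam ab • term ab = 0 := by
    have hd : (∑ ab, lam ab • term ab).totalDegree ≤ M :=
      totalDegree_finsetSum_le fun ab _ => (totalDegree_smul_le _ _).trans (hdeg ab)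
    ext s
    rw [coeff_zero]
    by_contra hs
    have hsi : ∀ i, s i < M + 1 := fun i => by
      have h1 := le_totalDegree (mem_support_iff.2 hs)
      have h2 : s i ≤ s.sum fun _ e => e := by
        by_cases hi : i ∈ s.support
        · exact Finset.single_le_sum (f := fun i => s i) (fun _ _ => Nat.zero_le _) hi
        · simp [Finsupp.notMem_support_iff.1 hi]
      omega
    have h3 := congrFun (LinearMap.mem_ker.1 hlam) fun i => ⟨s i, hsi i⟩
    refine hs ?_
    have h4 : toF (fun i => ⟨s i, hsi i⟩) = s := by
      ext i; simp [toF]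
    simpa [Φ, h4] using h3
  let toF' : (ι → Fin (A + 1)) → ι →₀ ℕ := fun b => Finsupp.equivFunOnFinite.symm fun i => (b i : ℕ)
  have htoF' : Function.Injective toF' := by
    intro b b' h
    ext i
    simpa [toF'] using DFunLike.congr_fun h i
  refine ⟨fun a => ∑ b, monomial (toF' b) (lam (a, b)), fun h => hne ?_, ?_⟩
  · ext ⟨a, b⟩
    have := congrArg (coeff (toF' b)) (congrFun h a)
    simpa [coeff_sum, coeff_monomial, htoF'.eq_iff] using this
  · rw [← hzero, Fintype.sum_prod_type]
    refine Finset.sum_congr rfl fun a _ => ?_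
    rw [map_sum, Finset.mul_sum]
    refine Finset.sum_congr rfl fun b _ => ?_
    rw [aeval_monomial, Finsupp.prod_fintype _ _ (by simp)]
    simp only [term, toF', Algebra.smul_def, algebraMap_eq, Finsupp.equivFunOnFinite_symm_apply_apply]
    ring

theorem exists_nat_injOn_moment {ι : Type*} [Fintype ι] (X : Finset (ι → ℝ)) :
    ∃ k < X.offDiag.card * Fintype.card ι + 1,
      Set.InjOn (fun x : ι → ℝ => ∑ i, (k : ℝ) ^ (Fintype.equivFin ι i : ℕ) * x i) X := by
  classical
  set W := Fintype.card ι
  let e := Fintype.equivFin ι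
  let h : (ι → ℝ) × (ι → ℝ) → Polynomial ℝ := fun vw =>
    ∑ i, Polynomial.C (vw.1 i - vw.2 i) * Polynomial.X ^ (e i : ℕ)
  have hne : ∏ vw ∈ X.offDiag, h vw ≠ 0 := by
    refine Finset.prod_ne_zero_iff.2 fun vw hvw h0 => (Finset.mem_offDiag.1 hvw).2.2 ?_
    ext i
    have := congrArg (fun P => Polynomial.coeff P (e i : ℕ)) h0
    simp only [h, Polynomial.finsetSum_coeff, Polynomial.coeff_C_mul_X_pow, Polynomial.coeff_zero,
      Fin.val_inj, e.injective.eq_iff, Finset.sum_ite_eq, Finset.mem_univ, if_true] at this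
    exact sub_eq_zero.1 this
  have hdeg : (∏ vw ∈ X.offDiag, h vw).natDegree ≤ X.offDiag.card * W := by
    refine (Polynomial.natDegree_prod_le _ _).trans ?_
    refine (Finset.sum_le_card_nsmul _ _ W fun vw _ => ?_).trans (by simp)
    refine Polynomial.natDegree_sum_le_of_forall_le _ _ fun i _ => ?_
    exact (Polynomial.natDegree_C_mul_X_pow_le _ _).trans (e i).2.le
  obtain ⟨k, hk⟩ : ∃ k : Fin (X.offDiag.card * W + 1),
      (∏ vw ∈ X.offDiag, h vw).eval ((k : ℕ) : ℝ) ≠ 0 := by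
    by_contra! hcon
    refine hne (Polynomial.eq_zero_of_natDegree_lt_card_of_eval_eq_zero _
      (f := fun k : Fin (X.offDiag.card * W + 1) => ((k : ℕ) : ℝ)) ?_ hcon ?_)
    · exact fun a b hab => Fin.ext (Nat.cast_injective hab)
    · simpa using Nat.lt_succ_of_le hdeg
  refine ⟨k, k.2, fun x hx y hy hxy => ?_⟩
  by_contra hne'
  rw [Polynomial.eval_prod] at hk
  refine Finset.prod_ne_zero_iff.1 hk (x, y) (Finset.mem_offDiag.2 ⟨hx, hy, hne'⟩) ?_
  simp only [h, Polynomial.eval_finsetSum, Polynomial.eval_mul, Polynomial.eval_C,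
    Polynomial.eval_pow, Polynomial.eval_X, sub_mul, Finset.sum_sub_distrib]
  rw [sub_eq_zero]
  simpa [mul_comm] using hxy

open MvPolynomial in
/-- A weak form of Bézout's inequality: a polynomial map whose fibres over a nonempty open set all
have at least `N` points satisfies `N ≤ (W * E + 1) ^ W`, where `W` is the number of variables and
`E` bounds the degrees. -/
theorem MvPolynomial.card_le_of_fibres {ι : Type*} [Fintype ι] (G : ι → MvPolynomial ι ℝ) (E : ℕ)
    (hG : ∀ i, (G i).totalDegree ≤ E) {U : Set (ι → ℝ)} (hU : IsOpen U) (hne : U.Nonempty) (N : ℕ)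
    (hN : ∀ c ∈ U, ∃ X : Finset (ι → ℝ), X.card = N ∧ ∀ x ∈ X, ∀ i, eval x (G i) = c i) :
    N ≤ (Fintype.card ι * E + 1) ^ Fintype.card ι := by
  classical
  by_contra! hlt
  set W := Fintype.card ι with hW
  set A := (W * E + 1) ^ W with hA
  let e := Fintype.equivFin ι
  let l : ℕ → MvPolynomial ι ℝ := fun k => ∑ i, C ((k : ℝ) ^ (e i : ℕ)) * X i
  have hl : ∀ k, (l k).totalDegree ≤ 1 := fun k =>
    totalDegree_finsetSum_le fun i _ =>
      (totalDegree_mul _ _).trans (by rw [totalDegree_C, totalDegree_X])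
  choose q hq0 hq using fun k => exists_relation (l k) (hl k) G E hG A hA.ge
  choose a ha using fun k => Function.ne_iff.1 (hq0 k)
  obtain ⟨c, hcU, hc⟩ := exists_eval_ne_zero_of_isOpen
    (F := ∏ k ∈ Finset.range (N * N * W + 1), q k (a k))
    (Finset.prod_ne_zero_iff.2 fun k _ => ha k) hU hne
  obtain ⟨X, hXN, hX⟩ := hN c hcU
  obtain ⟨k, hk, hinj⟩ := exists_nat_injOn_moment X
  have hkK : k < N * N * W + 1 := by
    refine hk.trans_le (Nat.succ_le_succ (Nat.mul_le_mul_right _ ?_))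
    rw [Finset.offDiag_card, hXN]
    exact Nat.sub_le _ _
  rw [map_prod] at hc
  have hck := Finset.prod_ne_zero_iff.1 hc k (Finset.mem_range.2 hkK)
  let P : Polynomial ℝ :=
    ∑ b : Fin (A + 1), Polynomial.C (eval c (q k b)) * Polynomial.X ^ (b : ℕ)
  have hP : P = 0 := by
    refine Polynomial.eq_zero_of_natDegree_lt_card_of_eval_eq_zero' P
      (X.image fun x => eval x (l k)) ?_ ?_
    · intro t ht
      obtain ⟨x, hx, rfl⟩ := Finset.mem_image.1 ht
      have h1 := congrArg (eval x) (hq k)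
      simp only [map_sum, map_mul, map_pow, map_zero] at h1
      rw [Polynomial.eval_finsetSum, ← h1]
      refine Finset.sum_congr rfl fun b _ => ?_
      have h2 : eval x (aeval G (q k b)) = eval c (q k b) := by
        have : (eval x).comp (eval₂Hom (algebraMap ℝ (MvPolynomial ι ℝ)) G) = eval c := by
          ext i
          · simp
          · simp [hX x hx i]
        exact RingHom.congr_fun this _
      rw [h2, Polynomial.eval_mul, Polynomial.eval_C, Polynomial.eval_pow, Polynomial.eval_X, mul_comm]
    · have hcard : (X.image fun x => eval x (l k)).card = N := by
        rw [Finset.card_image_of_injOn, hXN]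
        intro x hx y hy hxy
        exact hinj hx hy (by simpa [l] using hxy)
      rw [hcard]
      refine lt_of_le_of_lt ?_ hlt
      exact Polynomial.natDegree_sum_le_of_forall_le _ _ fun b _ =>
        (Polynomial.natDegree_C_mul_X_pow_le _ _).trans (Nat.lt_succ_iff.1 b.2)
  refine hck ?_
  have := congrArg (fun P => Polynomial.coeff P (a k : ℕ)) hP
  simpa [P, Polynomial.coeff_X_pow, Fin.val_inj] using this

open MvPolynomial Topology in
/-- A critical-point form of Warren's bound: a function which is locally constant off the zero set
of a polynomial takes few values there. -/
theorem MvPolynomial.card_le_of_eventually_eq {ι α : Type*} [Fintype ι] (F : MvPolynomial ι ℝ)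
    (E : ℕ) (hE : F.totalDegree ≤ E) (Φ : (ι → ℝ) → α)
    (hΦ : ∀ x, eval x F ≠ 0 → ∀ᶠ y in 𝓝 x, Φ y = Φ x) (A : Finset α)
    (hA : ∀ v ∈ A, ∃ x, eval x F ≠ 0 ∧ Φ x = v) :
    A.card ≤ (Fintype.card ι * (2 * (E + 2)) + 1) ^ Fintype.card ι := by
  classical
  choose! a haF haΦ using hA
  obtain ⟨R, hR⟩ : ∃ R : ℝ, ∀ v ∈ A, ∑ i, a v i ^ 2 < R := by
    obtain ⟨R, hR⟩ := (A.image fun v => ∑ i, a v i ^ 2).bddAbove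
    exact ⟨R + 1, fun v hv => lt_of_le_of_lt
      (hR (Finset.mem_coe.2 (Finset.mem_image_of_mem _ hv))) (lt_add_one R)⟩
  rcases A.eq_empty_or_nonempty with rfl | hAne
  · simp
  have hRpos : 0 < R := by
    obtain ⟨v, hv⟩ := hAne
    exact lt_of_le_of_lt (Finset.sum_nonneg fun i _ => sq_nonneg _) (hR v hv)
  let b : MvPolynomial ι ℝ := C R - ∑ i, X i ^ 2
  have hb : ∀ x, eval x b = R - ∑ i, x i ^ 2 := fun x => by simp [b]
  have hbdeg : b.totalDegree ≤ 2 := by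
    refine (totalDegree_sub _ _).trans (max_le (by simp) ?_)
    exact totalDegree_finsetSum_le fun i _ => (totalDegree_X_pow _ _).le
  let G : MvPolynomial ι ℝ := (F * b) ^ 2
  have hGdeg : G.totalDegree ≤ 2 * (E + 2) := by
    refine (totalDegree_pow _ _).trans (Nat.mul_le_mul_left _ ?_)
    exact (totalDegree_mul _ _).trans (add_le_add hE hbdeg)
  have hGa : ∀ v ∈ A, 0 < eval (a v) G := fun v hv => by
    have h1 : eval (a v) b ≠ 0 := by rw [hb]; exact (sub_pos.2 (hR v hv)).ne'
    have h2 := mul_ne_zero (haF v hv) h1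
    simp only [G, map_pow, map_mul]
    positivity
  obtain ⟨m, hm, hmle⟩ : ∃ m : ℝ, 0 < m ∧ ∀ v ∈ A, m ≤ eval (a v) G := by
    obtain ⟨v, hv, hmin⟩ := A.exists_min_image (fun v => eval (a v) G) hAne
    exact ⟨_, hGa v hv, hmin⟩
  set W := Fintype.card ι with hW
  have hcoord : ∀ x : ι → ℝ, ∑ i, x i ^ 2 ≤ R → ∀ i, |x i| ≤ R + 1 := fun x hx i => by
    have h1 : x i ^ 2 ≤ R :=
      (Finset.single_le_sum (f := fun i => x i ^ 2) (fun i _ => sq_nonneg _)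
        (Finset.mem_univ i)).trans hx
    exact abs_le_of_sq_le_sq (by nlinarith) (by linarith)
  let η : ℝ := m / (2 * (W + 1) * (R + 1))
  have hη : 0 < η := by positivity
  have hlin : ∀ c ∈ Metric.ball (0 : ι → ℝ) η, ∀ x : ι → ℝ, ∑ i, x i ^ 2 ≤ R →
      |∑ i, c i * x i| < m / 2 := fun c hc x hx => by
    have h1 : |∑ i, c i * x i| ≤ W * (η * (R + 1)) := by
      refine (Finset.abs_sum_le_sum_abs _ _).trans ?_
      refine (Finset.sum_le_card_nsmul _ _ (η * (R + 1)) fun i _ => ?_).trans (by simp [hW])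
      rw [abs_mul]
      refine mul_le_mul ?_ (hcoord x hx i) (abs_nonneg _) hη.le
      exact (norm_le_pi_norm c i).trans (mem_ball_zero_iff.1 hc).le
    refine h1.trans_lt ?_
    have h2 : (W + 1 : ℝ) * (η * (R + 1)) = m / 2 := by
      simp only [η]; field_simp
    nlinarith [mul_pos hη (by linarith : 0 < R + 1)]
  refine card_le_of_fibres (fun i => pderiv i G) _
    (fun i => (totalDegree_pderiv_le i G).trans hGdeg) Metric.isOpen_ball
    ⟨0, Metric.mem_ball_self hη⟩ _ fun c hc => ?_
  suffices h : ∀ v ∈ A, ∃ x, Φ x = v ∧ ∀ i, eval x (pderiv i G) = c i by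
    choose! x hxΦ hxc using h
    refine ⟨A.image x, Finset.card_image_of_injOn fun v hv w hw h => ?_, ?_⟩
    · rw [← hxΦ v hv, h, hxΦ w hw]
    · intro y hy
      obtain ⟨v, hv, rfl⟩ := Finset.mem_image.1 hy
      exact hxc v hv
  intro v hv
  let H : MvPolynomial ι ℝ := G - ∑ i, C (c i) * X i
  have hH : ∀ x, eval x H = eval x G - ∑ i, c i * x i := fun x => by simp [H]
  let K : Set (ι → ℝ) := {x | ∑ i, x i ^ 2 ≤ R} ∩ closure {x | Φ x = v}
  have hK : IsCompact K := by
    refine Metric.isCompact_of_isClosed_isBounded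
      ((isClosed_le (by fun_prop) continuous_const).inter isClosed_closure) ?_
    refine (Metric.isBounded_closedBall (x := (0 : ι → ℝ)) (r := R + 1)).subset fun x hx => ?_
    rw [mem_closedBall_zero_iff, pi_norm_le_iff_of_nonneg (by linarith)]
    exact hcoord x hx.1
  have haK : a v ∈ K := ⟨(hR v hv).le, subset_closure (haΦ v hv)⟩
  obtain ⟨x, hxK, hmax⟩ := hK.exists_isMaxOn ⟨_, haK⟩ (continuous_eval H).continuousOn
  have hGx : 0 < eval x G := by
    have h1 : eval (a v) H ≤ eval x H := hmax haK
    rw [hH, hH] at h1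
    have h2 := abs_lt.1 (hlin c hc x hxK.1)
    have h3 := abs_lt.1 (hlin c hc (a v) haK.1)
    linarith [hmle v hv]
  have hFb : eval x F ≠ 0 ∧ eval x b ≠ 0 := by
    rw [← mul_ne_zero_iff, ← map_mul]
    intro h0
    rw [map_pow, h0] at hGx
    norm_num at hGx
  have hxR : ∑ i, x i ^ 2 < R := lt_of_le_of_ne hxK.1 fun h => hFb.2 (by rw [hb, h, sub_self])
  have hev := hΦ x hFb.1
  have hxv : Φ x = v := by
    obtain ⟨y, hy, hyv⟩ := (mem_closure_iff_frequently.1 hxK.2).and_eventually hev |>.exists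
    exact hyv.symm.trans hy
  have hloc : IsLocalMax (fun y => eval y H) x := by
    have h1 : ∀ᶠ y : ι → ℝ in 𝓝 x, ∑ i, y i ^ 2 < R :=
      (isOpen_lt (by fun_prop) continuous_const).mem_nhds hxR
    filter_upwards [hev, h1] with y hy hyR
    exact hmax ⟨hyR.le, subset_closure (hy.trans hxv)⟩
  refine ⟨x, hxv, fun i => ?_⟩
  have hloc' : IsLocalMax (fun t => eval (Function.update x i t) H) (x i) := by
    refine IsLocalMax.comp_continuous (f := fun y => eval y H)
      (g := fun t => Function.update x i t) ?_ (by fun_prop)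
    rwa [Function.update_eq_self]
  have h0 := hloc'.hasDerivAt_eq_zero (hasDerivAt_eval_update H x i (x i))
  rw [Function.update_eq_self] at h0
  have hp : pderiv i H = pderiv i G - C (c i) := by
    simp only [H, map_sub, map_sum, Derivation.leibniz, pderiv_C, smul_eq_mul, mul_zero,
      add_zero]
    congr 1
    rw [Finset.sum_eq_single i (fun j _ hj => by rw [pderiv_X_of_ne hj, mul_zero])
      (by simp), pderiv_X_self, mul_one]
  rw [hp, map_sub, eval_C] at h0
  exact sub_eq_zero.1 h0

/-- The weight matrices with entries given by a finite parameter vector. -/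
def paramMat {d L : ℕ} (θ : Fin L × Fin d × Fin d → ℝ) (ℓ : ℕ) : Matrix (Fin d) (Fin d) ℝ :=
  Matrix.of fun i k => if h : ℓ - 1 < L then θ (⟨ℓ - 1, h⟩, i, k) else 0

open MvPolynomial in
/-- The output of the virtual network as a polynomial in its weights, when the active units are
prescribed by `s`. -/
noncomputable def patternPoly {d L : ℕ} (z : Fin d → ℝ) (s : Fin L → Fin d → Bool) :
    ℕ → Fin d → MvPolynomial (Fin L × Fin d × Fin d) ℝ
  | 0 => fun k => C (z k)
  | ℓ + 1 => fun i =>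
      if h : ℓ < L then
        ∑ k, X (⟨ℓ, h⟩, i, k) * (if ℓ = 0 ∨ s ⟨ℓ, h⟩ k = true then patternPoly z s ℓ k else 0)
      else 0

open MvPolynomial in
theorem totalDegree_patternPoly_le {d L : ℕ} (z : Fin d → ℝ) (s : Fin L → Fin d → Bool) (ℓ : ℕ) :
    ∀ k, (patternPoly z s ℓ k).totalDegree ≤ ℓ := by
  induction ℓ with
  | zero => intro k; simp [patternPoly]
  | succ ℓ ih =>
    intro i
    rw [patternPoly]
    split_ifs with h
    · refine totalDegree_finsetSum_le fun k _ => (totalDegree_mul _ _).trans ?_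
      rw [totalDegree_X, add_comm]
      refine Nat.add_le_add_right ?_ 1
      split_ifs
      · exact ih k
      · simp
    · simp

open MvPolynomial in
theorem vnetOut_eq_eval_patternPoly {d L : ℕ} (z : Fin d → ℝ) (s : Fin L → Fin d → Bool)
    (θ : Fin L × Fin d × Fin d → ℝ)
    (hs : ∀ (ℓ : ℕ) (h : ℓ < L) (k : Fin d),
      vnetOut d relu (paramMat θ) z ℓ k = eval θ (patternPoly z s ℓ k) →
        (s ⟨ℓ, h⟩ k = true ↔ 0 < eval θ (patternPoly z s ℓ k))) (ℓ : ℕ) :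
    ℓ ≤ L → ∀ k, vnetOut d relu (paramMat θ) z ℓ k = eval θ (patternPoly z s ℓ k) := by
  induction ℓ with
  | zero => intro _ k; simp [patternPoly, vnetOut]
  | succ ℓ ih =>
    intro hℓ i
    have h : ℓ < L := hℓ
    have ih := ih h.le
    simp only [patternPoly, dif_pos h, map_sum, vnetOut, Matrix.mulVec, dotProduct]
    refine Finset.sum_congr rfl fun k _ => ?_
    rw [map_mul, eval_X]
    congr 1
    · simp [paramMat, h]
    · by_cases h0 : ℓ = 0
      · rw [if_pos h0, if_pos (Or.inl h0), ih k]
      · have hsk := hs ℓ h k (ih k)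
        by_cases hk : s ⟨ℓ, h⟩ k = true
        · rw [if_neg h0, if_pos (Or.inr hk), ih k, relu, max_eq_left (hsk.1 hk).le]
        · rw [if_neg h0, if_neg (by tauto), ih k, relu, map_zero,
            max_eq_right (not_lt.1 (mt hsk.2 hk))]

theorem vnetOut_congr {d : ℕ} {act : ℝ → ℝ} {Ws Ws' : ℕ → Matrix (Fin d) (Fin d) ℝ}
    {z : Fin d → ℝ} {L : ℕ} (h : ∀ ℓ < L, Ws (ℓ + 1) = Ws' (ℓ + 1)) :
    vnetOut d act Ws z L = vnetOut d act Ws' z L := by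
  induction L with
  | zero => rfl
  | succ L ih =>
    rw [vnetOut, vnetOut, h L (Nat.lt_succ_self L), ih fun ℓ hℓ => h ℓ (hℓ.trans (Nat.lt_succ_self L))]

theorem continuous_vnetOut {Y : Type*} [TopologicalSpace Y] {d : ℕ}
    {Ws : Y → ℕ → Matrix (Fin d) (Fin d) ℝ} {z : Y → Fin d → ℝ}
    (hW : ∀ ℓ i k, Continuous fun y => Ws y ℓ i k) (hz : Continuous z) (ℓ : ℕ) :
    Continuous fun y => vnetOut d relu (Ws y) (z y) ℓ := by
  induction ℓ with
  | zero => exact hz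
  | succ ℓ ih =>
    refine continuous_pi fun i => ?_
    simp only [vnetOut, Matrix.mulVec, dotProduct]
    refine continuous_finsetSum _ fun k _ => (hW _ _ _).mul ?_
    have hk : Continuous fun y => vnetOut d relu (Ws y) (z y) ℓ k := (continuous_apply k).comp ih
    split_ifs
    · exact hk
    · exact hk.max continuous_const

theorem continuous_paramMat {d L : ℕ} (ℓ : ℕ) (i k : Fin d) :
    Continuous fun θ : Fin L × Fin d × Fin d → ℝ => paramMat θ ℓ i k := by
  simp only [paramMat, Matrix.of_apply]
  split_ifs <;> fun_prop

open MvPolynomial Topology in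
theorem two_pow_card_le_of_shatters {d L : ℕ} {J : Type*} [Fintype J] (z : J → Fin d → ℝ)
    (k₀ : Fin d)
    (hsh : ∀ σ : J → Bool, ∃ Ws : ℕ → Matrix (Fin d) (Fin d) ℝ, ∀ j,
      (σ j = true → 0 < vnetOut d relu Ws (z j) L k₀) ∧
      (σ j = false → vnetOut d relu Ws (z j) L k₀ < 0)) :
    2 ^ Fintype.card J ≤
      (L * (d * d) * (2 * (Fintype.card J * 2 ^ (L * d) * ((L + 1) * d) * L + 2)) + 1)
        ^ (L * (d * d)) := by
  classical
  let P : J × (Fin L → Fin d → Bool) × Fin (L + 1) × Fin d →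
      MvPolynomial (Fin L × Fin d × Fin d) ℝ := fun t => patternPoly (z t.1) t.2.1 t.2.2.1 t.2.2.2
  let F := ∏ t, if P t = 0 then 1 else P t
  have hF : F ≠ 0 := Finset.prod_ne_zero_iff.2 fun t _ => by
    split_ifs with h
    · exact one_ne_zero
    · exact h
  have hFdeg : F.totalDegree ≤ Fintype.card J * 2 ^ (L * d) * ((L + 1) * d) * L := by
    refine (totalDegree_finsetProd _ _).trans ?_
    refine (Finset.sum_le_card_nsmul _ _ L fun t _ => ?_).trans (le_of_eq ?_)
    · split_ifs
      · simp
      · exact (totalDegree_patternPoly_le _ _ _ _).trans (Nat.lt_succ_iff.1 t.2.2.1.2)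
    · simp [← pow_mul, mul_comm d L, mul_assoc]
  let g : (Fin L × Fin d × Fin d → ℝ) → J → ℝ := fun θ j => vnetOut d relu (paramMat θ) (z j) L k₀
  have hg : ∀ j, Continuous fun θ => g θ j := fun j =>
    (continuous_apply k₀).comp (continuous_vnetOut continuous_paramMat continuous_const L)
  let Φ : (Fin L × Fin d × Fin d → ℝ) → J → Bool := fun θ j => decide (0 < g θ j)
  have hΦ : ∀ θ, eval θ F ≠ 0 → ∀ᶠ θ' in 𝓝 θ, Φ θ' = Φ θ := by
    intro θ hθ
    have hsign : ∀ᶠ θ' in 𝓝 θ, ∀ t, 0 < eval θ' (P t) ↔ 0 < eval θ (P t) := by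
      refine Filter.eventually_all.2 fun t => ?_
      by_cases ht : P t = 0
      · simp [ht]
      · have hne : eval θ (P t) ≠ 0 := by
          rw [map_prod] at hθ
          simpa [ht] using Finset.prod_ne_zero_iff.1 hθ t (Finset.mem_univ t)
        have hc : Continuous fun θ' => eval θ' (P t) := continuous_eval _
        rcases hne.lt_or_gt with h | h
        · filter_upwards [hc.continuousAt.eventually_lt_const h] with θ' h'
          exact iff_of_false h'.not_gt h.not_gt
        · filter_upwards [hc.continuousAt.eventually_const_lt h] with θ' h'
          exact iff_of_true h' h
    filter_upwards [hsign] with θ' hθ'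
    ext j
    let s : Fin L → Fin d → Bool :=
      fun ℓ k => decide (0 < vnetOut d relu (paramMat θ) (z j) ℓ k)
    have h1 := vnetOut_eq_eval_patternPoly (z j) s θ fun ℓ h k he => by simp [s, he]
    have h2 := vnetOut_eq_eval_patternPoly (z j) s θ' fun ℓ h k _ => by
      rw [hθ' (j, s, ⟨ℓ, h.trans (Nat.lt_succ_self L)⟩, k)]
      simp [s, P, h1 ℓ h.le]
    simp only [Φ, g, h1 L le_rfl, h2 L le_rfl]
    exact decide_eq_decide.2 (hθ' (j, s, ⟨L, Nat.lt_succ_self L⟩, k₀))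
  have key := card_le_of_eventually_eq F _ hFdeg Φ hΦ Finset.univ fun σ _ => by
    obtain ⟨Ws, hWs⟩ := hsh σ
    let θ₀ : Fin L × Fin d × Fin d → ℝ := fun t => Ws (t.1 + 1) t.2.1 t.2.2
    have hθ₀ : ∀ j, g θ₀ j = vnetOut d relu Ws (z j) L k₀ := fun j => by
      refine congrFun (vnetOut_congr fun ℓ hℓ => ?_) k₀
      ext i k
      simp [paramMat, θ₀, hℓ]
    obtain ⟨θ, hθ, hθF⟩ := exists_eval_ne_zero_of_isOpen hF
      (U := {θ | ∀ j, if σ j = true then 0 < g θ j else g θ j < 0})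
      (by
        rw [Set.ofPred_forall]
        refine isOpen_iInter_of_finite fun j => ?_
        split_ifs
        · exact isOpen_lt continuous_const (hg j)
        · exact isOpen_lt (hg j) continuous_const)
      ⟨θ₀, fun j => by
        rw [hθ₀]
        split_ifs with h
        · exact (hWs j).1 h
        · exact (hWs j).2 (by simpa using h)⟩
    refine ⟨θ, hθF, ?_⟩
    ext j
    have := hθ j
    by_cases h : σ j = true
    · simpa [Φ, h] using this
    · simp only [h, Bool.false_eq_true, if_false] at this
      simpa [Φ, h] using this.le
  simpa using key

theorem le_of_two_pow_le {d L m : ℕ} (hd : 0 < d) (hL : 0 < L)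
    (h : 2 ^ m ≤ (L * (d * d) * (2 * (m * 2 ^ (L * d) * ((L + 1) * d) * L + 2)) + 1)
        ^ (L * (d * d))) :
    m ≤ (6 * (L * (d * d))) ^ 2 := by
  rcases Nat.eq_zero_or_pos m with rfl | hm
  · exact Nat.zero_le _
  set W := L * (d * d) with hW
  set a := L * d with ha
  have hapos : 1 ≤ a := Nat.mul_pos hL hd
  have haW : a ≤ W := by rw [ha, hW]; nlinarith
  have hWa : W ≤ a * a := by
    rw [ha, hW]; nlinarith [Nat.mul_pos hd hd, Nat.mul_le_mul_right (d * d * L) hL]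
  have h2a : a ≤ 2 ^ a := Nat.lt_two_pow_self.le
  have h4a : a * a ≤ 2 ^ a * 2 ^ a := Nat.mul_le_mul h2a h2a
  have hLa : (L + 1) * d * L ≤ 2 * (a * a) := by
    rw [ha]
    calc (L + 1) * d * L ≤ (2 * L) * d * (L * d) := by gcongr <;> nlinarith
      _ = 2 * (L * d * (L * d)) := by ring
  have hbase : W * (2 * (m * 2 ^ a * ((L + 1) * d) * L + 2)) + 1 ≤ m * 2 ^ (9 * a) := by
    have h1 : m * 2 ^ a * ((L + 1) * d) * L ≤ m * 2 ^ a * (2 * (2 ^ a * 2 ^ a)) := by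
      rw [mul_assoc]
      exact Nat.mul_le_mul_left _ (hLa.trans (Nat.mul_le_mul_left 2 h4a))
    have h2 : 1 ≤ m * (2 ^ a) ^ 3 := Nat.mul_pos hm (by positivity)
    have h3 : 1 ≤ m * (2 ^ a) ^ 5 := Nat.mul_pos hm (by positivity)
    have h4 : 2 ^ 4 ≤ 2 ^ (4 * a) := Nat.pow_le_pow_right (by norm_num) (by omega)
    calc W * (2 * (m * 2 ^ a * ((L + 1) * d) * L + 2)) + 1
        ≤ (2 ^ a * 2 ^ a) * (2 * (m * 2 ^ a * (2 * (2 ^ a * 2 ^ a)) + 2 * (m * (2 ^ a) ^ 3)))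
            + m * (2 ^ a) ^ 5 := by
          gcongr
          · exact hWa.trans h4a
          · omega
      _ = 9 * (m * (2 ^ a) ^ 5) := by ring
      _ ≤ 2 ^ (4 * a) * (m * (2 ^ a) ^ 5) := Nat.mul_le_mul_right _ (le_trans (by norm_num) h4)
      _ = m * 2 ^ (9 * a) := by ring
  set s := Nat.sqrt m with hs
  have hms : m < (s + 1) * (s + 1) := Nat.lt_succ_sqrt m
  have hsm : s * s ≤ m := Nat.sqrt_le m
  have hm2 : m ≤ 2 ^ (2 * s) := by
    have h1 : s + 1 ≤ 2 ^ s := Nat.lt_two_pow_self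
    calc m ≤ (s + 1) * (s + 1) := hms.le
      _ ≤ 2 ^ s * 2 ^ s := Nat.mul_le_mul h1 h1
      _ = 2 ^ (2 * s) := by ring
  have hexp : 2 ^ m ≤ 2 ^ ((2 * s + 9 * a) * W) := by
    refine h.trans ?_
    rw [pow_mul 2 _ W]
    refine Nat.pow_le_pow_left (hbase.trans ?_) W
    rw [pow_add]
    exact Nat.mul_le_mul_right _ hm2
  have hm3 : m ≤ (2 * s + 9 * a) * W := (Nat.pow_le_pow_iff_right (by norm_num)).1 hexp
  have hsW : s + 1 ≤ 6 * W := by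
    by_contra! hcon
    nlinarith
  calc m ≤ (s + 1) * (s + 1) := hms.le
    _ ≤ (6 * W) * (6 * W) := Nat.mul_le_mul hsW hsW
    _ = (6 * W) ^ 2 := by ring

/-- Iterated partial derivatives along a list of coordinate directions. -/
noncomputable def iteratedPartial {p : ℕ} : List (Fin p) → ((Fin p → ℝ) → ℝ) → (Fin p → ℝ) → ℝ
  | [], g => g
  | i :: is, g => iteratedPartial is fun x => fderiv ℝ g x (Pi.single i 1)

open scoped ContDiff in
theorem contDiff_fderiv_apply {E : Type*} [NormedAddCommGroup E] [NormedSpace ℝ E] {g : E → ℝ}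
    (hg : ContDiff ℝ ∞ g) (v : E) : ContDiff ℝ ∞ fun x => fderiv ℝ g x v :=
  (hg.fderiv_right (m := ∞) (by simp)).clm_apply contDiff_const

theorem uniqueDiffOn_unitCube (p : ℕ) : UniqueDiffOn ℝ (unitCube p) := by
  have h : unitCube p = Set.pi Set.univ fun _ => Set.Icc (0 : ℝ) 1 :=
    (Set.pi_univ_Icc (0 : Fin p → ℝ) 1).symm
  rw [h]
  exact UniqueDiffOn.univ_pi fun _ => uniqueDiffOn_Icc_zero_one

open scoped ContDiff in
theorem pderivList_eq_iteratedPartial {p : ℕ} (ls : List (Fin p)) :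
    ∀ {f g : (Fin p → ℝ) → ℝ}, ContDiff ℝ ∞ g → Set.EqOn f g (unitCube p) →
      Set.EqOn (pderivList p ls f) (iteratedPartial ls g) (unitCube p) := by
  induction ls with
  | nil => exact fun _ h => h
  | cons i is ih =>
    intro f g hg hfg
    refine ih (contDiff_fderiv_apply hg _) fun x hx => ?_
    rw [pderivW, fderivWithin_congr hfg (hfg hx),
      (hg.differentiable (by simp)).differentiableAt.fderivWithin (uniqueDiffOn_unitCube p x hx)]

open scoped ContDiff in
theorem continuous_iteratedPartial {p : ℕ} (ls : List (Fin p)) :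
    ∀ {g : (Fin p → ℝ) → ℝ}, ContDiff ℝ ∞ g → Continuous (iteratedPartial ls g) := by
  induction ls with
  | nil => exact fun hg => hg.continuous
  | cons i is ih => exact fun hg => ih (contDiff_fderiv_apply hg _)

theorem iteratedPartial_eq_zero {p : ℕ} (ls : List (Fin p)) {r : ℝ} :
    ∀ {g : (Fin p → ℝ) → ℝ}, (∀ y, r < ‖y‖ → g y = 0) →
      ∀ y, r < ‖y‖ → iteratedPartial ls g y = 0 := by
  induction ls with
  | nil => exact fun hg => hg
  | cons i is ih =>
    intro g hg
    refine ih fun y hy => ?_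
    have h : g =ᶠ[nhds y] fun _ => 0 := by
      filter_upwards [(isOpen_lt continuous_const continuous_norm).mem_nhds hy] with z hz
      exact hg z hz
    simp [h.fderiv_eq]

open scoped ContDiff in
theorem iteratedPartial_sum_comp {p : ℕ} {K : Type*} [Fintype K] (b : K → Fin p → ℝ) (n : ℝ)
    (ls : List (Fin p)) :
    ∀ (a : K → ℝ) {g : (Fin p → ℝ) → ℝ}, ContDiff ℝ ∞ g →
      iteratedPartial ls (fun x => ∑ k, a k * g (n • x - b k)) =
        fun x => ∑ k, a k * n ^ ls.length * iteratedPartial ls g (n • x - b k) := by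
  induction ls with
  | nil => intro a g _; simp [iteratedPartial]
  | cons i is ih =>
    intro a g hg
    have h : (fun x => fderiv ℝ (fun x => ∑ k, a k * g (n • x - b k)) x (Pi.single i 1)) =
        fun x => ∑ k, (a k * n) * fderiv ℝ g (n • x - b k) (Pi.single i 1) := by
      ext x
      have h1 : ∀ k, HasFDerivAt (fun x => a k * g (n • x - b k))
          (a k • ((fderiv ℝ g (n • x - b k)).comp (n • ContinuousLinearMap.id ℝ (Fin p → ℝ)))) x :=
        fun k => by
          have h2 : HasFDerivAt (fun x : Fin p → ℝ => n • x - b k)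
              (n • ContinuousLinearMap.id ℝ (Fin p → ℝ)) x :=
            ((hasFDerivAt_id x).const_smul n).sub_const _
          exact (((hg.differentiable (by simp)).differentiableAt.hasFDerivAt).comp x h2).const_mul _
      rw [(HasFDerivAt.fun_sum fun k (_ : k ∈ Finset.univ) => h1 k).fderiv]
      simp [mul_assoc]
    rw [iteratedPartial, h, ih _ (contDiff_fderiv_apply hg _)]
    ext x
    simp [iteratedPartial, pow_succ', mul_assoc]

open scoped ContDiff in
/-- Smooth functions in the unit ball of the Hölder class with prescribed values of order `n ^ (-β)`
on the grid of mesh `1 / n`. -/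
theorem exists_mem_Hclass_grid (p β : ℕ) :
    ∃ c : ℝ, 0 < c ∧ ∀ n : ℕ, 0 < n → ∀ σ : (Fin p → Fin n) → ℝ, (∀ k, |σ k| ≤ 1) →
      ∃ f ∈ Hclass p β, ∀ k : Fin p → Fin n,
        f (fun i => ((k i : ℕ) : ℝ) / n) = σ k * (c / (n : ℝ) ^ β) := by
  classical
  let φ : ContDiffBump (0 : Fin p → ℝ) := ⟨1 / 4, 1 / 3, by norm_num, by norm_num⟩
  have hφ : ContDiff ℝ ∞ φ := φ.contDiff
  have hφ0 : ∀ y : Fin p → ℝ, 1 / 3 < ‖y‖ → φ y = 0 := fun y hy =>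
    φ.zero_of_le_dist (by rw [dist_zero_right]; exact hy.le)
  have hφ1 : φ 0 = 1 := φ.one_of_mem_closedBall (Metric.mem_closedBall_self (by norm_num [φ]))
  obtain ⟨M, hM0, hM⟩ : ∃ M : ℝ, 0 ≤ M ∧ ∀ ls : List (Fin p), ls.length ≤ β → ∀ y,
      |iteratedPartial ls φ y| ≤ M := by
    have h1 : ∀ ls : List (Fin p), ∃ M : ℝ, ∀ y, |iteratedPartial ls φ y| ≤ M := fun ls => by
      obtain ⟨M, hM⟩ := (isCompact_closedBall (0 : Fin p → ℝ) (1 / 3)).exists_bound_of_continuousOn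
        (continuous_iteratedPartial ls hφ).continuousOn
      refine ⟨max M 0, fun y => ?_⟩
      by_cases hy : ‖y‖ ≤ 1 / 3
      · exact (hM y (by simpa using hy)).trans (le_max_left _ _)
      · simp [iteratedPartial_eq_zero ls hφ0 y (not_le.1 hy)]
    choose m hm using h1
    obtain ⟨M, hM⟩ := ((List.finite_length_le (Fin p) β).image m).bddAbove
    exact ⟨max M 0, le_max_right _ _, fun ls hls y =>
      (hm ls y).trans ((hM (Set.mem_image_of_mem m hls)).trans (le_max_left _ _))⟩
  refine ⟨1 / (M + 1), by positivity, fun n hn σ hσ => ?_⟩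
  have hn1 : (1 : ℝ) ≤ n := Nat.one_le_cast.2 hn
  have hn0 : (0 : ℝ) < n := by linarith
  let b : (Fin p → Fin n) → Fin p → ℝ := fun k i => ((k i : ℕ) : ℝ)
  have hb : ∀ k k' y, ‖y - b k‖ ≤ 1 / 3 → ‖y - b k'‖ ≤ 1 / 3 → k = k' := by
    intro k k' y h h'
    ext i
    have h1 : |y i - (k i : ℕ)| ≤ 1 / 3 := (norm_le_pi_norm (y - b k) i).trans h
    have h2 : |y i - (k' i : ℕ)| ≤ 1 / 3 := (norm_le_pi_norm (y - b k') i).trans h'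
    rw [abs_le] at h1 h2
    have h3 : ((k i : ℕ) : ℝ) < (k' i : ℕ) + 1 := by linarith
    have h4 : ((k' i : ℕ) : ℝ) < (k i : ℕ) + 1 := by linarith
    norm_cast at h3 h4
    omega
  let a : (Fin p → Fin n) → ℝ := fun k => σ k * (1 / (M + 1) / (n : ℝ) ^ β)
  let f : (Fin p → ℝ) → ℝ := fun x => ∑ k, a k * φ ((n : ℝ) • x - b k)
  have hf : ContDiff ℝ ∞ f := by
    refine ContDiff.sum fun k _ => contDiff_const.mul (hφ.comp ?_)
    exact (contDiff_id.const_smul (n : ℝ)).sub contDiff_const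
  refine ⟨f, ⟨(hf.of_le (by exact_mod_cast le_top)).contDiffOn, fun ls hls x hx => ?_⟩, fun k => ?_⟩
  · rw [pderivList_eq_iteratedPartial ls hf (Set.eqOn_refl _ _) hx,
      iteratedPartial_sum_comp b n ls a hφ]
    beta_reduce
    by_cases hk : ∃ k, ‖(n : ℝ) • x - b k‖ ≤ 1 / 3
    · obtain ⟨k, hk⟩ := hk
      rw [Finset.sum_eq_single k (fun k' _ hk' => ?_) (by simp)]
      · rw [abs_mul, abs_mul, abs_mul]
        have h1 : |1 / (M + 1) / (n : ℝ) ^ β| * |(n : ℝ) ^ ls.length| ≤ 1 / (M + 1) := by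
          rw [abs_of_nonneg (by positivity), abs_of_nonneg (by positivity), div_mul_eq_mul_div,
            div_le_iff₀ (by positivity)]
          exact mul_le_mul_of_nonneg_left (pow_le_pow_right₀ hn1 hls) (by positivity)
        calc |σ k| * |1 / (M + 1) / (n : ℝ) ^ β| * |(n : ℝ) ^ ls.length| *
              |iteratedPartial ls φ ((n : ℝ) • x - b k)|
            ≤ 1 * (1 / (M + 1)) * M := by
              rw [mul_assoc |σ k|]
              exact mul_le_mul (mul_le_mul (hσ k) h1 (by positivity) zero_le_one)
                (hM ls hls _) (abs_nonneg _) (by positivity)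
          _ ≤ 1 := by rw [one_mul, one_div_mul_eq_div, div_le_one (by positivity)]; linarith
      · rw [iteratedPartial_eq_zero ls hφ0 _ (not_le.1 fun h => hk' (hb _ _ _ h hk)), mul_zero]
    · push Not at hk
      rw [Finset.sum_eq_zero fun k _ => ?_]
      · simp
      · rw [iteratedPartial_eq_zero ls hφ0 _ (hk k), mul_zero]
  · have hx : (n : ℝ) • (fun i => ((k i : ℕ) : ℝ) / n) = b k := by
      ext i
      simp only [Pi.smul_apply, smul_eq_mul, b]
      field_simp
    simp only [f, hx]
    rw [Finset.sum_eq_single k (fun k' _ hk' => ?_) (by simp)]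
    · rw [sub_self, hφ1, mul_one]
    · have h0 : φ (b k - b k') = 0 := hφ0 _ (not_le.1 fun h =>
        hk' (hb _ _ (b k) h (by simp)))
      rw [h0, mul_zero]

theorem exists_mesh_size {p β : ℕ} (hp : 0 < p) (hβ : 0 < β) {c D : ℝ} (hc : 0 < c) (hD : 1 ≤ D) :
    ∃ C : ℝ, 0 < C ∧ ∀ ε : ℝ, 0 < ε → ∀ L : ℕ, 0 < L →
      (L : ℝ) ≤ C * ε ^ (-(p : ℝ) / (2 * (β : ℝ))) →
        ∃ n : ℕ, 0 < n ∧ ε ≤ c / (n : ℝ) ^ β ∧ (D * L) ^ 2 < (n : ℝ) ^ p := by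
  have hβ' : (0 : ℝ) < β := Nat.cast_pos.2 hβ
  set κ : ℝ := c ^ ((p : ℝ) / (2 * β)) with hκ
  have hκ0 : 0 < κ := Real.rpow_pos_of_pos hc _
  refine ⟨κ / (2 * D * 2 ^ p), by positivity, fun ε hε L hL hLC => ?_⟩
  set Y : ℝ := ε ^ (-(p : ℝ) / (2 * (β : ℝ))) with hY
  have hY0 : 0 < Y := Real.rpow_pos_of_pos hε _
  have hL1 : (1 : ℝ) ≤ L := Nat.one_le_cast.2 hL
  set X : ℝ := (c / ε) ^ ((1 : ℝ) / β) with hX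
  have hX0 : 0 < X := Real.rpow_pos_of_pos (by positivity) _
  have hXβ : X ^ β = c / ε := by
    rw [hX, one_div, Real.rpow_inv_natCast_pow (by positivity) hβ.ne']
  have hXp : X ^ p = (κ * Y) ^ 2 := by
    rw [hX, hκ, hY, neg_div, Real.rpow_neg hε.le, ← div_eq_mul_inv,
      ← Real.div_rpow hc.le hε.le, ← Real.rpow_natCast, ← Real.rpow_natCast,
      ← Real.rpow_mul (by positivity), ← Real.rpow_mul (by positivity)]
    congr 1
    push_cast
    field_simp
  have hLX : (D * L) * 2 * 2 ^ p ≤ κ * Y := by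
    rw [div_mul_eq_mul_div, le_div_iff₀ (by positivity)] at hLC
    linarith
  have h2p : (1 : ℝ) ≤ 2 ^ p := one_le_pow₀ one_le_two
  have hDL : 1 ≤ D * L := one_le_mul_of_one_le_of_one_le hD hL1
  have hlt : 2 ^ p * (D * L) ^ 2 < X ^ p := by
    rw [hXp]
    calc 2 ^ p * (D * L) ^ 2 < ((D * L) * 2 * 2 ^ p) ^ 2 := by
          have : 0 < 2 ^ p * (D * (L : ℝ)) ^ 2 := by positivity
          nlinarith [mul_le_mul_of_nonneg_left h2p this.le]
      _ ≤ _ := pow_le_pow_left₀ (by positivity) hLX 2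
  have hX2 : 2 < X := by
    refine lt_of_pow_lt_pow_left₀ p hX0.le (lt_of_le_of_lt ?_ hlt)
    exact le_mul_of_one_le_right (by positivity) (one_le_pow₀ hDL)
  have hn : X / 2 < (⌊X⌋₊ : ℝ) := by
    have := Nat.lt_floor_add_one X
    linarith
  have hn0 : (0 : ℝ) < (⌊X⌋₊ : ℝ) := by linarith
  refine ⟨⌊X⌋₊, Nat.cast_pos.1 hn0, ?_, ?_⟩
  · rw [le_div_iff₀ (by positivity), ← le_div_iff₀' hε, ← hXβ]
    exact pow_le_pow_left₀ hn0.le (Nat.floor_le hX0.le) β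
  · calc (D * L) ^ 2 < (X / 2) ^ p := by
          rw [div_pow, lt_div_iff₀ (by positivity)]
          linarith
      _ ≤ _ := pow_le_pow_left₀ (by positivity) hn.le p

theorem embed_mem_Icc (d : ℕ) {p : ℕ} {x : Fin p → ℝ} (hx : x ∈ unitCube p) (k : Fin d) :
    embed d p x k ∈ Set.Icc (0 : ℝ) 1 := by
  unfold embed
  split_ifs
  · exact ⟨hx.1 _, hx.2 _⟩
  · simp
  · simp

theorem continuous_embed (d p : ℕ) : Continuous (embed d p) := by
  refine continuous_pi fun k => ?_
  unfold embed
  split_ifs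
  · exact continuous_apply _
  · exact continuous_const
  · exact continuous_const

theorem fhat_eq_vnetOut {d : ℕ} (hd : 0 < d)
    {forward : List (Fin (4 * d + 8) → ℝ) → List (Fin (4 * d + 8) → ℝ)} {act : ℝ → ℝ}
    (h : EmulatesWith d forward act) {B : ℝ} (hB : 1 ≤ B) {T L : ℕ} (hT : 0 < T) (hL : 0 < L)
    {S : ℝ} (hS : max ((d : ℝ) * B ^ (4 * L) * (T : ℝ) ^ (2 * L)) (2 * (L : ℝ)) ≤ S)
    {u : Fin T → Fin d → ℝ} {w : Fin T → ℕ} (huw : ValidPrompt (eball d B) T L u w)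
    {p : ℕ} {x : Fin p → ℝ} (hx : x ∈ unitCube p) :
    fhat forward u w S L p x = vnetOut d act (WPfam u w 0) (embed d p x) L ⟨0, hd⟩ := by
  have h1 := h B hB T L hT hL (eball d B) subset_rfl S hS u w huw 1 one_pos
    (fun _ => embed d p x) (fun _ => embed_mem_Icc d hx) 0 L hL le_rfl
  have h2 : T + 1 * L + ((0 : Fin 1) : ℕ) + 1 = T + 1 + L := by simp; omega
  rw [h2] at h1
  rw [fhat, h1, promptToken, dif_pos hd]
  rfl

/-- Point evaluations on the unit cube are controlled by `supDist` as soon as `f` is bounded and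
`g` agrees with a continuous function. -/
theorem abs_sub_le_supDist {p : ℕ} {f g g' : (Fin p → ℝ) → ℝ} (hf : ContinuousOn f (unitCube p))
    (hg' : Continuous g') (hg : Set.EqOn g g' (unitCube p)) {x : Fin p → ℝ}
    (hx : x ∈ unitCube p) : |f x - g x| ≤ supDist p f g := by
  have hcont : ContinuousOn (fun x => |f x - g x|) (unitCube p) :=
    (hf.sub (hg'.continuousOn.congr hg)).abs
  obtain ⟨M, hM⟩ := (isCompact_Icc.image_of_continuousOn hcont).bddAbove
  refine le_ciSup (f := fun x : unitCube p => |f x.1 - g x.1|) ⟨M, ?_⟩ ⟨x, hx⟩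
  rintro _ ⟨y, rfl⟩
  exact hM ⟨y.1, y.2, rfl⟩

/-- If all functions of the Hölder class are approximated to accuracy below `ε` by depth-`L`
networks of width `d`, then the grid of bumps of height at least `ε` cannot be too fine. -/
theorem card_grid_le_of_approx {p β d L n : ℕ} (hd : 0 < d) (hL : 0 < L) (hn : 0 < n) {ε c : ℝ}
    (hε : ε ≤ c / (n : ℝ) ^ β)
    (hc : ∀ σ : (Fin p → Fin n) → ℝ, (∀ k, |σ k| ≤ 1) →
      ∃ f ∈ Hclass p β, ∀ k : Fin p → Fin n,
        f (fun i => ((k i : ℕ) : ℝ) / n) = σ k * (c / (n : ℝ) ^ β))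
    (happ : ∀ f ∈ Hclass p β, ∃ Ws : ℕ → Matrix (Fin d) (Fin d) ℝ, ∀ x ∈ unitCube p,
      |f x - vnetOut d relu Ws (embed d p x) L ⟨0, hd⟩| < ε) :
    n ^ p ≤ (6 * (L * (d * d))) ^ 2 := by
  have hn0 : (0 : ℝ) < n := Nat.cast_pos.2 hn
  have hcube : ∀ k : Fin p → Fin n, (fun i => ((k i : ℕ) : ℝ) / n) ∈ unitCube p := fun k =>
    ⟨fun i => div_nonneg (Nat.cast_nonneg _) hn0.le,
      fun i => (div_le_one hn0).2 (Nat.cast_le.2 (k i).2.le)⟩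
  have hcard : Fintype.card (Fin p → Fin n) = n ^ p := by simp
  rw [← hcard]
  refine le_of_two_pow_le hd hL (two_pow_card_le_of_shatters
    (fun k : Fin p → Fin n => embed d p fun i => ((k i : ℕ) : ℝ) / n) ⟨0, hd⟩ fun σ => ?_)
  obtain ⟨f, hf, hfk⟩ := hc (fun k => if σ k then 1 else -1)
    (fun k => by split_ifs <;> simp)
  obtain ⟨Ws, hWs⟩ := happ f hf
  refine ⟨Ws, fun k => ⟨fun hk => ?_, fun hk => ?_⟩⟩
  all_goals
    have h1 := abs_lt.1 (hWs _ (hcube k))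
    rw [hfk k] at h1
    simp only [hk, if_true, Bool.false_eq_true, if_false] at h1
    linarith [h1.1, h1.2]

/-- Lower bound in terms of the inference depth: there is `C'' > 0`
depending only on `β, p, d` such that for every `ε ∈ (0,1)` one can choose a threshold
`S* > 0` with: if `L ≤ C''·ε^{−p/(2β)}`, then
`sup_f inf_{S ≥ S*, H^P ∈ Q_{B_d(B)}(T,L,S)} ‖f̂ − f‖_∞ ≥ ε`. -/
theorem statement_16 (p β : ℕ) (hp : 0 < p) (hβ : 0 < β) (d : ℕ) (hd : p + 1 ≤ d) :
    ∃ C'' : ℝ, 0 < C'' ∧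
      ∀ B : ℝ, 1 ≤ B → ∀ T : ℕ, 0 < T →
      ∀ ε : ℝ, 0 < ε → ε < 1 →
        ∃ Sstar : ℝ, 0 < Sstar ∧
          ∀ Θ : List (TFLayer (4 * d + 8)), EmulatesWith d (tfForward Θ) relu →
          ∀ L : ℕ, 0 < L → (L : ℝ) ≤ C'' * ε ^ (-(p : ℝ) / (2 * (β : ℝ))) →
          ∀ δ : ℝ, 0 < δ →
            ∃ f ∈ Hclass p β,
              ∀ S : ℝ, Sstar ≤ S →
              ∀ (T' : ℕ) (u : Fin T' → Fin d → ℝ) (w : Fin T' → ℕ),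
                1 ≤ T' → T' ≤ T → ValidPrompt (eball d B) T' L u w →
                ε - δ ≤ supDist p f (fhat (tfForward Θ) u w S L p) := by
  obtain ⟨c, hc0, hc⟩ := exists_mem_Hclass_grid p β
  have hd0 : 0 < d := by omega
  have hd1 : (1 : ℝ) ≤ d := Nat.one_le_cast.2 hd0
  obtain ⟨C, hC0, hC⟩ := exists_mesh_size (D := 6 * (d * d)) hp hβ hc0 (by nlinarith)
  refine ⟨C, hC0, fun B hB T hT ε hε _ => ?_⟩
  set Lm : ℕ := ⌊C * ε ^ (-(p : ℝ) / (2 * (β : ℝ)))⌋₊ with hLm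
  refine ⟨max ((d : ℝ) * B ^ (4 * Lm) * (T : ℝ) ^ (2 * Lm)) (2 * (Lm : ℝ)) + 1,
    by positivity, fun Θ hΘ L hL hLC δ hδ => ?_⟩
  obtain ⟨n, hn, hεn, hlt⟩ := hC ε hε L hL hLC
  have hLLm : L ≤ Lm := Nat.le_floor hLC
  by_contra! hcon
  have hle := card_grid_le_of_approx hd0 hL hn hεn (hc n hn) fun f hf => by
    obtain ⟨S, hS, T', u, w, hT'1, hT'T, huw, hdist⟩ := hcon f hf
    have hT1 : (1 : ℝ) ≤ T' := Nat.one_le_cast.2 hT'1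
    have hTT : (T' : ℝ) ≤ T := Nat.cast_le.2 hT'T
    have hSL : max ((d : ℝ) * B ^ (4 * L) * (T' : ℝ) ^ (2 * L)) (2 * (L : ℝ)) ≤ S := by
      refine le_trans (max_le_max ?_ ?_) ((le_add_of_nonneg_right zero_le_one).trans hS)
      · have h1 : B ^ (4 * L) ≤ B ^ (4 * Lm) := pow_le_pow_right₀ hB (by omega)
        have h2 : (T' : ℝ) ^ (2 * L) ≤ (T : ℝ) ^ (2 * Lm) :=
          (pow_le_pow_right₀ hT1 (by omega)).trans (pow_le_pow_left₀ (by positivity) hTT _)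
        gcongr
      · gcongr
    have heq : ∀ x ∈ unitCube p, fhat (tfForward Θ) u w S L p x =
        vnetOut d relu (WPfam u w 0) (embed d p x) L ⟨0, hd0⟩ := fun x hx =>
      fhat_eq_vnetOut hd0 hΘ hB hT'1 hL hSL huw hx
    refine ⟨WPfam u w 0, fun x hx => ?_⟩
    have hcts : Continuous fun x => vnetOut d relu (WPfam u w 0) (embed d p x) L ⟨0, hd0⟩ :=
      (continuous_apply _).comp
        (continuous_vnetOut (Ws := fun _ => WPfam u w 0) (fun _ _ _ => continuous_const)
          (continuous_embed d p) L)
    have h := abs_sub_le_supDist hf.1.continuousOn hcts heq hx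
    rw [heq x hx] at h
    linarith
  have hle' : ((n : ℝ)) ^ p ≤ (6 * (L * (d * d))) ^ 2 := by exact_mod_cast hle
  have heq : 6 * ((d : ℝ) * d) * L = 6 * (L * (d * d)) := by ring
  rw [heq] at hlt
  exact absurd hle' (not_le.2 hlt)
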